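/- Let p ≡ 3 (mod 4) be prime and M = (3p-1)/4. Then modulo p^5: Σ_{k=0}^{M} (8k+1) ((1/4)_k)^4/(k!)^4 ≡ ((1/2)_{(3p-1)/4}/(1)_{(3p-1)/4}) · (3p - (27p^3/16) H^{(2)}_{(3p-1)/4}) + 81 p^4 Σ_{k=1}^{(3p-1)/4} (1)_{k-1}(1/2)_{k-1} / ((4k-3)^3 ((1/4)_{k-1})^2), where H^{(2)}_m = Σ_{j=1}^m 1/j^2. -/

import Mathlib

open Finset

/-- `A ≡ B (mod p^e)` for rational numbers, in the p-adic sense: the difference can be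
written as `p^e · a / b` with `b` an integer not divisible by `p`. -/
def ratCongr (A B : ℚ) (p : ℕ) (e : ℕ) : Prop :=
  ∃ a b : ℤ, ¬ (p : ℤ) ∣ b ∧ (A - B) * (b : ℚ) = (p : ℚ) ^ e * (a : ℚ)

/-- The Pochhammer symbol (rising factorial) `(a)_k = a(a+1)⋯(a+k-1)` for rational `a`. -/
noncomputable def rpoch (a : ℚ) (k : ℕ) : ℚ := (ascPochhammer ℚ k).eval a

/-- The harmonic number of order 2: `H^{(2)}_m = Σ_{j=1}^m 1/j^2`. -/
def H2 (m : ℕ) : ℚ := ∑ j ∈ Finset.Icc 1 m, 1 / (j : ℚ) ^ 2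

@[simp] theorem rpoch_zero (a : ℚ) : rpoch a 0 = 1 := by simp [rpoch]

theorem rpoch_succ (a : ℚ) (k : ℕ) : rpoch a (k + 1) = rpoch a k * (a + k) := by
  simp [rpoch, ascPochhammer_succ_eval]

theorem rpoch_eq_prod (a : ℚ) (k : ℕ) : rpoch a k = ∏ i ∈ range k, (a + i) := by
  induction k with
  | zero => simp
  | succ k ih => rw [rpoch_succ, ih, prod_range_succ]

theorem rpoch_add (a : ℚ) (m k : ℕ) : rpoch a (m + k) = rpoch a m * rpoch (a + m) k := by
  induction k with
  | zero => simp
  | succ k ih =>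
    rw [← add_assoc, rpoch_succ, ih, rpoch_succ]; push_cast; ring

theorem rpoch_succ_left (a : ℚ) (k : ℕ) : rpoch a (k + 1) = a * rpoch (a + 1) k := by
  have h := rpoch_add a 1 k
  rw [add_comm 1 k] at h
  rw [h, rpoch_succ]; simp

theorem rpoch_one (k : ℕ) : rpoch 1 k = k.factorial := by
  induction k with
  | zero => simp
  | succ k ih => rw [rpoch_succ, ih, Nat.factorial_succ]; push_cast; ring

theorem rpoch_ne_zero {a : ℚ} (h : ∀ i : ℕ, a + i ≠ 0) (k : ℕ) : rpoch a k ≠ 0 := by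
  rw [rpoch_eq_prod]; exact prod_ne_zero_iff.2 fun i _ => h i

theorem rpoch_reflect (a : ℚ) (k : ℕ) : rpoch a k = (-1) ^ k * rpoch (1 - a - k) k := by
  rw [rpoch_eq_prod, rpoch_eq_prod, ← prod_range_reflect, ← card_range k, ← prod_const, card_range,
    ← prod_mul_distrib]
  refine prod_congr rfl fun i hi => ?_
  have := mem_range.1 hi
  rw [Nat.sub_sub, Nat.cast_sub (by omega)]; push_cast; ring

theorem rpoch_neg_eq_zero (N : ℕ) {k : ℕ} (h : N < k) : rpoch (-N) k = 0 := by
  rw [rpoch_eq_prod]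
  exact prod_eq_zero (mem_range.2 h) (by simp)

theorem rpoch_neg_natCast {N k : ℕ} (h : k ≤ N) :
    rpoch (-N) k = (-1) ^ k * N.factorial / (N - k).factorial := by
  induction k with
  | zero => simp [Nat.factorial_ne_zero]
  | succ k ih =>
    obtain ⟨m, rfl⟩ := Nat.exists_eq_add_of_le h
    have e1 : k + 1 + m - k = m + 1 := by omega
    have e2 : k + 1 + m - (k + 1) = m := by omega
    rw [rpoch_succ, ih (by omega), e1, e2, Nat.factorial_succ m]
    have := Nat.factorial_ne_zero m
    field_simp
    push_cast
    ring

/-- Terminating very-well-poised `₅F₄` summation. -/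
theorem sum_very_well_poised (A d e : ℚ) (hA : 0 < A) (hd : ∀ i : ℕ, 1 + A - d + i ≠ 0)
    (he : ∀ i : ℕ, 1 + A - e + i ≠ 0) (N : ℕ) :
    ∑ k ∈ range (N + 1), (A + 2 * k) * (rpoch A k * rpoch d k * rpoch e k * rpoch (-N) k) /
        (k.factorial * rpoch (1 + A - d) k * rpoch (1 + A - e) k * rpoch (1 + A + N) k) =
      rpoch A (N + 1) * rpoch (1 + A - d - e) N / (rpoch (1 + A - d) N * rpoch (1 + A - e) N) := by
  have hd' := rpoch_ne_zero hd
  have he' := rpoch_ne_zero he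
  induction N with
  | zero => simp [rpoch_succ]
  | succ N ih =>
    have hN : ∀ i : ℕ, 1 + A + N + i ≠ 0 := fun i => by positivity
    have hN' := rpoch_ne_zero hN
    have hN1 : (1 + A + N) ≠ 0 := by positivity
    have shift : ∀ k, rpoch (1 + A + (N + 1 : ℕ)) k =
        rpoch (1 + A + N) k * (1 + A + N + k) / (1 + A + N) := by
      intro k
      rw [eq_div_iff hN1, ← rpoch_succ, rpoch_succ_left]; push_cast; ring_nf
    set ρ : ℚ := (1 + A + N) * (1 + A - d - e + N) / ((1 + A - d + N) * (1 + A - e + N)) with hρ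
    have hdN := hd N
    have heN := he N
    have key : ∀ K : ℕ, ∑ k ∈ range (K + 1),
        ((A + 2 * k) * (rpoch A k * rpoch d k * rpoch e k * rpoch (-(N + 1 : ℕ)) k) /
          (k.factorial * rpoch (1 + A - d) k * rpoch (1 + A - e) k *
            rpoch (1 + A + (N + 1 : ℕ)) k) -
        ρ * ((A + 2 * k) * (rpoch A k * rpoch d k * rpoch e k * rpoch (-N) k) /
          (k.factorial * rpoch (1 + A - d) k * rpoch (1 + A - e) k * rpoch (1 + A + N) k))) =
        (1 + A + N) / ((1 + A - d + N) * (1 + A - e + N)) *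
          (rpoch A (K + 1) * rpoch d (K + 1) * rpoch e (K + 1) * rpoch (-N) K) /
          (K.factorial * rpoch (1 + A - d) K * rpoch (1 + A - e) K * rpoch (1 + A + N) (K + 1)) := by
      intro K
      induction K with
      | zero =>
        simp [rpoch_succ, hρ]
        field_simp
        ring
      | succ K ihK =>
        rw [sum_range_succ, ihK, shift]
        have e1 : rpoch (-(N + 1 : ℕ)) (K + 1) = (-(N + 1)) * rpoch (-N) K := by
          rw [rpoch_succ_left]; push_cast; ring_nf
        rw [e1, rpoch_succ A (K + 1), rpoch_succ d (K + 1), rpoch_succ e (K + 1),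
          rpoch_succ (1 + A + N) (K + 1), rpoch_succ (1 + A + N) K,
          rpoch_succ (-(N : ℚ)) K, rpoch_succ (1 + A - d), rpoch_succ (1 + A - e),
          Nat.factorial_succ]
        have h1 := hd K
        have h2 := he K
        have h3 := hd' K
        have h4 := he' K
        have h5 := hN' K
        have h6 := hN K
        have h7 := hN (K + 1)
        have h8 : ((K.factorial : ℕ) : ℚ) ≠ 0 := by positivity
        have h9 : (K : ℚ) + 1 ≠ 0 := by positivity
        generalize rpoch A (K + 1) = u1
        generalize rpoch d (K + 1) = u2
        generalize rpoch e (K + 1) = u3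
        generalize rpoch (1 + A - d) K = u4 at *
        generalize rpoch (1 + A - e) K = u5 at *
        generalize rpoch (1 + A + N) K = u6 at *
        generalize rpoch (-(N : ℚ)) K = u7
        rw [hρ]
        push_cast at *
        field_simp
        ring
    have drop := sum_range_succ (fun k : ℕ => (A + 2 * k) *
      (rpoch A k * rpoch d k * rpoch e k * rpoch (-N) k) /
        (k.factorial * rpoch (1 + A - d) k * rpoch (1 + A - e) k * rpoch (1 + A + N) k)) (N + 1)
    rw [rpoch_neg_eq_zero N (Nat.lt_succ_self N), ih] at drop
    have h := key (N + 1)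
    rw [sum_sub_distrib, ← mul_sum, rpoch_neg_eq_zero N (Nat.lt_succ_self N), drop] at h
    simp only [mul_zero, zero_div, add_zero, sub_eq_zero] at h
    rw [h, hρ, rpoch_succ A (N + 1), rpoch_succ (1 + A - d - e) N, rpoch_succ (1 + A - d) N,
      rpoch_succ (1 + A - e) N]
    have h3 := hd' N
    have h4 := he' N
    push_cast
    field_simp
    ring

/-- Partial fractions in `x` of `(a + x)_k k! / ((a)_k (1 - x)_k)`. -/
theorem partial_fraction (a x : ℚ) (ha : 0 < a) (hx : ∀ i : ℕ, x - i ≠ 0) (k : ℕ) :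
    ∑ j ∈ range (k + 1), rpoch (-k) j * rpoch (a + k) j / (j.factorial * rpoch a j) * (x / (x - j)) =
      rpoch (a + x) k * k.factorial / (rpoch a k * rpoch (1 - x) k) := by
  have ha0 : ∀ i : ℕ, a + i ≠ 0 := fun i => by positivity
  have ha' := rpoch_ne_zero ha0
  have hx1 : ∀ i : ℕ, 1 - x + i ≠ 0 := fun i h => hx (i + 1) (by push_cast; linarith)
  have hx' := rpoch_ne_zero hx1
  have hx0 : x ≠ 0 := by simpa using hx 0
  induction k with
  | zero => simp [hx0]
  | succ k ih =>
    set ρ : ℚ := (a + x + k) * (k + 1) / ((a + k) * (1 - x + k)) with hρ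
    have hak := ha0 k
    have hxk := hx1 k
    have key : ∀ J : ℕ, ∑ j ∈ range (J + 1),
        (rpoch (-(k + 1 : ℕ)) j * rpoch (a + (k + 1 : ℕ)) j / (j.factorial * rpoch a j) *
          (x / (x - j)) -
        ρ * (rpoch (-k) j * rpoch (a + k) j / (j.factorial * rpoch a j) * (x / (x - j)))) =
        -(x * (a + 2 * k + 1) / ((1 - x + k) * (a + k))) *
          (rpoch (-k) J * rpoch (a + k) (J + 1) / (J.factorial * rpoch a J)) / (a + k) := by
      intro J
      induction J with
      | zero =>
        simp [rpoch_succ, hρ]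
        field_simp
        ring
      | succ J ihJ =>
        have e1 : rpoch (-(k + 1 : ℕ)) (J + 1) = (-(k + 1)) * rpoch (-k) J := by
          rw [rpoch_succ_left]; push_cast; ring_nf
        have e2 : rpoch (a + (k + 1 : ℕ)) (J + 1) = rpoch (a + k) (J + 1) * (a + k + J + 1) /
            (a + k) := by
          rw [eq_div_iff hak, mul_comm, Nat.cast_succ, ← add_assoc, ← rpoch_succ_left, rpoch_succ]
          push_cast; ring
        rw [sum_range_succ, ihJ, e1, e2, rpoch_succ (a + k) (J + 1), rpoch_succ (-(k : ℚ)) J,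
          rpoch_succ a J, Nat.factorial_succ]
        have h1 := ha0 J
        have h2 := ha' J
        have h3 := hx (J + 1)
        have h8 : ((J.factorial : ℕ) : ℚ) ≠ 0 := by positivity
        have h9 : (J : ℚ) + 1 ≠ 0 := by positivity
        generalize rpoch (a + k) (J + 1) = u1
        generalize rpoch a J = u2 at *
        generalize rpoch (-(k : ℚ)) J = u3
        rw [hρ]
        push_cast at *
        field_simp
        ring
    have drop := sum_range_succ (fun j : ℕ => rpoch (-k) j * rpoch (a + k) j /
      (j.factorial * rpoch a j) * (x / (x - j))) (k + 1)
    rw [rpoch_neg_eq_zero k (Nat.lt_succ_self k), ih] at drop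
    have h := key (k + 1)
    rw [sum_sub_distrib, ← mul_sum, rpoch_neg_eq_zero k (Nat.lt_succ_self k), drop] at h
    simp only [mul_zero, zero_mul, zero_div, add_zero, sub_eq_zero] at h
    rw [h, hρ, rpoch_succ (a + x), rpoch_succ a, rpoch_succ (1 - x), Nat.factorial_succ]
    have h3 := ha' k
    have h4 := hx' k
    push_cast
    field_simp

theorem poised_term_algebra {u1 u2 u3 u4 r1 r2 r3 r4 r5 r6 r7 r8 r9 r10 r11 r12 r13 r14 s1 s2 s3 s4 s5 : ℚ}
    (h : u1 * u2 = u3 * u4) (h1 : r1 ≠ 0) (h2 : r2 ≠ 0) (h9 : r9 ≠ 0) (h3 : r3 ≠ 0) (h4 : r4 ≠ 0)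
    (h5 : r5 ≠ 0) (h6 : r6 ≠ 0) (h7 : r7 ≠ 0) (h8 : r8 ≠ 0) (h13 : r13 ≠ 0) :
    r11 * (r14 * s1 * u1 * (s2 * s3) * (s4 * s5)) / (r3 * r9 * r7 * (r4 * r1) * (r5 * r2)) *
      (r12 * r7 / r8 * u2 / (r13 * r6) * r10) =
    r12 * r14 * s2 * s4 * u3 / (r3 * r4 * r5 * (r13 * r6)) * r10 *
      (r11 * (u4 * s3 * s5 * s1) / (r8 * r1 * r2 * r9)) := by
  field_simp
  linear_combination r11 * r14 * s1 * s2 * s3 * s4 * s5 * r12 * r10 * h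

theorem whipple_term_algebra {r1 r2 r3 r4 r5 r6 r7 r8 r9 r10 r11 r12 r13 r14 r15 r16 r17 : ℚ}
    (h : r7 * r3 = r8 * r9) (sgn : r17 * r17 = 1) (h1 : r1 ≠ 0) (h2 : r2 ≠ 0) (h3 : r3 ≠ 0)
    (h4 : r4 ≠ 0) (h5 : r5 ≠ 0) (h6 : r6 ≠ 0) (h12 : r12 ≠ 0) (h13 : r13 ≠ 0) :
    r17 * (r17 * r11 / r12) * r14 * r15 * r8 / (r3 * r4 * r5 * (r13 * r6)) * r16 *
      (r9 * r10 / (r1 * r2)) =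
    r7 / (r4 * r1 * (r5 * r2)) * (r16 * (r11 / (r13 * r12)) * (r14 * r15 / r6) * r10) := by
  rw [eq_div_of_mul_eq h3 h]
  field_simp
  linear_combination r16 * r14 * r15 * r11 * r8 * r9 * r10 * sgn

/-- A case of Whipple's transformation of a terminating very-well-poised `₇F₆`. -/
theorem whipple_transform (a d e x : ℚ) (n : ℕ) (ha : 0 < a) (hx : ∀ i : ℕ, x - i ≠ 0)
    (hd : ∀ i : ℕ, 1 + a - d + i ≠ 0) (he : ∀ i : ℕ, 1 + a - e + i ≠ 0) :
    ∑ k ∈ range (n + 1), (a + 2 * k) * (rpoch (-n) k * rpoch (a + x) k * rpoch d k * rpoch e k) /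
        (rpoch (1 + a + n) k * rpoch (1 - x) k * rpoch (1 + a - d) k * rpoch (1 + a - e) k) =
      rpoch a (n + 1) / (rpoch (1 + a - d) n * rpoch (1 + a - e) n) *
        ∑ j ∈ range (n + 1), x / (x - j) * n.choose j * (rpoch d j * rpoch e j / rpoch a j) *
          rpoch (1 + a - d - e) (n - j) := by
  have ha0 : ∀ i : ℕ, a + i ≠ 0 := fun i => by positivity
  have ha' := rpoch_ne_zero ha0
  have hx1 : ∀ i : ℕ, 1 - x + i ≠ 0 := fun i h => hx (i + 1) (by push_cast; linarith)
  have hx' := rpoch_ne_zero hx1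
  have hd' := rpoch_ne_zero hd
  have he' := rpoch_ne_zero he
  have hn' := rpoch_ne_zero (a := 1 + a + n) (fun i => by positivity)
  have expand : ∀ k ∈ range (n + 1),
      (a + 2 * k) * (rpoch (-n) k * rpoch (a + x) k * rpoch d k * rpoch e k) /
        (rpoch (1 + a + n) k * rpoch (1 - x) k * rpoch (1 + a - d) k * rpoch (1 + a - e) k) =
      ∑ j ∈ range (n + 1), (a + 2 * k) * (rpoch (-n) k * rpoch a k * rpoch d k * rpoch e k) /
        (rpoch (1 + a + n) k * k.factorial * rpoch (1 + a - d) k * rpoch (1 + a - e) k) *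
        (rpoch (-k) j * rpoch (a + k) j / (j.factorial * rpoch a j) * (x / (x - j))) := by
    intro k hk
    have hkn : k + 1 ≤ n + 1 := mem_range.1 hk
    rw [← mul_sum, ← sum_subset (range_subset_range.2 hkn), partial_fraction a x ha hx k]
    · have h1 := ha' k
      have h2 := hx' k
      have h3 := hd' k
      have h4 := he' k
      have h5 := hn' k
      have h8 : ((k.factorial : ℕ) : ℚ) ≠ 0 := by positivity
      field_simp
    · intro j _ hj
      rw [rpoch_neg_eq_zero k (by simpa using hj)]; simp
  rw [sum_congr rfl expand, sum_comm, mul_sum]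
  refine sum_congr rfl fun j hj => ?_
  obtain ⟨N, rfl⟩ := Nat.exists_eq_add_of_le (Nat.lt_succ_iff.1 (mem_range.1 hj))
  rw [add_assoc j N 1, sum_range_add, sum_eq_zero, zero_add, Nat.add_sub_cancel_left]
  swap
  · intro k hk
    rw [rpoch_neg_eq_zero k (mem_range.1 hk)]; simp
  have h5F4 := sum_very_well_poised (a + 2 * j) (d + j) (e + j) (by positivity)
    (fun i => by have := hd (j + i); push_cast at this; convert this using 1; ring)
    (fun i => by have := he (j + i); push_cast at this; convert this using 1; ring) N
  have c1 : 1 + (a + 2 * j) - (d + j) = 1 + a - d + j := by ring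
  have c2 : 1 + (a + 2 * j) - (e + j) = 1 + a - e + j := by ring
  have c3 : 1 + a - d + j - (e + j) = 1 + a - d - e := by ring
  rw [c1, c2, c3] at h5F4
  have term : ∀ i ∈ range (N + 1),
      (a + 2 * (j + i : ℕ)) * (rpoch (-(j + N : ℕ)) (j + i) * rpoch a (j + i) * rpoch d (j + i) *
          rpoch e (j + i)) /
        (rpoch (1 + a + (j + N : ℕ)) (j + i) * (j + i).factorial * rpoch (1 + a - d) (j + i) *
          rpoch (1 + a - e) (j + i)) *
        (rpoch (-(j + i : ℕ)) j * rpoch (a + (j + i : ℕ)) j / (j.factorial * rpoch a j) *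
          (x / (x - j))) =
      ((-1) ^ j * rpoch (-(j + N : ℕ)) j * rpoch d j * rpoch e j * rpoch a (2 * j) /
        (rpoch (1 + a + (j + N : ℕ)) j * rpoch (1 + a - d) j * rpoch (1 + a - e) j *
          (j.factorial * rpoch a j)) * (x / (x - j))) *
      ((a + 2 * j + 2 * i) * (rpoch (a + 2 * j) i * rpoch (d + j) i * rpoch (e + j) i *
          rpoch (-N) i) / (i.factorial * rpoch (1 + a - d + j) i * rpoch (1 + a - e + j) i *
          rpoch (1 + (a + 2 * j) + N) i)) := by
    intro i hi
    have e1 : rpoch a (j + i) * rpoch (a + (j + i : ℕ)) j =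
        rpoch a (2 * j) * rpoch (a + 2 * j) i := by
      rw [← rpoch_add, show j + i + j = 2 * j + i by ring, rpoch_add]; push_cast; ring
    have e2 : rpoch (-(j + N : ℕ)) (j + i) = rpoch (-(j + N : ℕ)) j * rpoch (-N) i := by
      rw [rpoch_add]; push_cast; ring_nf
    have e3 : rpoch (1 + a + (j + N : ℕ)) (j + i) =
        rpoch (1 + a + (j + N : ℕ)) j * rpoch (1 + (a + 2 * j) + N) i := by
      rw [rpoch_add]; push_cast; ring_nf
    rw [e2, e3, rpoch_add d, rpoch_add e, rpoch_add (1 + a - d), rpoch_add (1 + a - e),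
      rpoch_neg_natCast (Nat.le_add_right j i), Nat.add_sub_cancel_left]
    have hf : (((j + i).factorial : ℕ) : ℚ) ≠ 0 := by positivity
    have hf' : ((i.factorial : ℕ) : ℚ) ≠ 0 := by positivity
    have q1 : rpoch (1 + a - d + j) i ≠ 0 := fun h => hd' (j + i) (by rw [rpoch_add, h, mul_zero])
    have q2 : rpoch (1 + a - e + j) i ≠ 0 := fun h => he' (j + i) (by rw [rpoch_add, h, mul_zero])
    have q3 : rpoch (1 + (a + 2 * j) + N) i ≠ 0 := fun h => hn' (j + i) (by rw [e3, h, mul_zero])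
    have q4 := hn' j
    have q5 := hd' j
    have q6 := he' j
    have q7 := ha' j
    have q8 := hx j
    rw [show a + 2 * ((j + i : ℕ) : ℚ) = a + 2 * j + 2 * i by push_cast; ring]
    exact poised_term_algebra e1 q1 q2 q3 q4 q5 q6 q7 hf hf' (by positivity)
  rw [sum_congr rfl term, ← mul_sum, h5F4]
  have e4 : rpoch a (j + (N + 1)) * rpoch (1 + a + (j + N : ℕ)) j =
      rpoch a (2 * j) * rpoch (a + 2 * j) (N + 1) := by
    have := rpoch_add a (j + N + 1) j
    rw [show j + N + 1 + j = 2 * j + (N + 1) by ring, rpoch_add] at this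
    rw [← add_assoc]
    push_cast at *
    rw [this]
    ring_nf
  rw [Nat.choose_eq_factorial_div_factorial (Nat.le_add_right j N), Nat.cast_div
    (Nat.factorial_mul_factorial_dvd_factorial (Nat.le_add_right j N)) (by positivity),
    Nat.add_sub_cancel_left, rpoch_neg_natCast (Nat.le_add_right j N), Nat.add_sub_cancel_left,
    rpoch_add (1 + a - d), rpoch_add (1 + a - e)]
  have q1 : rpoch (1 + a - d + j) N ≠ 0 := fun h => hd' (j + N) (by rw [rpoch_add, h, mul_zero])
  have q2 : rpoch (1 + a - e + j) N ≠ 0 := fun h => he' (j + N) (by rw [rpoch_add, h, mul_zero])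
  have q4 := hn' j
  have q5 := hd' j
  have q6 := he' j
  have q7 := ha' j
  have q8 := hx j
  have hf' : ((N.factorial : ℕ) : ℚ) ≠ 0 := by positivity
  have hj' : ((j.factorial : ℕ) : ℚ) ≠ 0 := by positivity
  have sgn : ((-1 : ℚ) ^ j) * (-1) ^ j = 1 := by rw [← mul_pow]; simp
  rw [Nat.cast_mul]
  exact whipple_term_algebra e4 sgn q1 q2 q4 q5 q6 q7 hf' hj'

theorem H2_zero : H2 0 = 0 := by simp [H2]

theorem H2_succ (m : ℕ) : H2 (m + 1) = H2 m + 1 / ((m : ℚ) + 1) ^ 2 := by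
  rw [H2, sum_Icc_succ_top (by omega), H2]; push_cast; ring

theorem H2_sub_eq_sum {n j : ℕ} (h : j ≤ n) :
    H2 n - H2 (n - j) = ∑ i ∈ range j, 1 / ((i : ℚ) - n) ^ 2 := by
  induction j with
  | zero => simp
  | succ j ih =>
    obtain ⟨m, rfl⟩ := Nat.exists_eq_add_of_le h
    have h1 := ih (by omega)
    rw [show j + 1 + m - j = m + 1 by omega, H2_succ] at h1
    rw [sum_range_succ, ← h1, show j + 1 + m - (j + 1) = m by omega]
    push_cast
    rw [show ((j : ℚ) - (j + 1 + m)) ^ 2 = (m + 1) ^ 2 by ring]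
    ring

/-- The weights of a sum of differences of harmonic numbers of order 2. -/
def harmonicWeight (n j : ℕ) : ℚ :=
  (-1) ^ (n + j) * (n + j).factorial * n.factorial ^ 2 /
    (j.factorial ^ 2 * (n - j).factorial * (n - j) * (2 * n).factorial)

theorem harmonicWeight_succ_right (j m : ℕ) :
    harmonicWeight (j + 2 + m) (j + 1) =
      -harmonicWeight (j + 2 + m) j * ((2 * j + 3 + m) * (m + 2) ^ 2) / ((j + 1) ^ 2 * (m + 1)) := by
  have h1 : j + 2 + m - (j + 1) = m + 1 := by omega
  have h2 : j + 2 + m - j = m + 2 := by omega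
  have h3 : j + 2 + m + (j + 1) = (j + 2 + m + j) + 1 := by ring
  have f2 : (m + 2).factorial = (m + 2) * (m + 1).factorial := Nat.factorial_succ _
  have d1 : ((j + 2 + m : ℕ) : ℚ) - (j + 1 : ℕ) = m + 1 := by push_cast; ring
  have d2 : ((j + 2 + m : ℕ) : ℚ) - j = m + 2 := by push_cast; ring
  rw [harmonicWeight, harmonicWeight, h1, h2, h3, f2, d1, d2, Nat.factorial_succ j,
    Nat.factorial_succ (j + 2 + m + j), pow_succ]
  have := Nat.factorial_ne_zero j
  have := Nat.factorial_ne_zero (m + 1)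
  have := Nat.factorial_ne_zero (2 * (j + 2 + m))
  push_cast
  field_simp
  ring

theorem harmonicWeight_pred_left (j m : ℕ) :
    harmonicWeight (j + 1 + m) j =
      -harmonicWeight (j + 2 + m) j * (2 * (2 * j + 2 * m + 3) * (m + 2) ^ 2) /
        ((j + 2 + m) * (2 * j + 2 + m) * (m + 1)) := by
  have h1 : j + 1 + m - j = m + 1 := by omega
  have h2 : j + 2 + m - j = m + 2 := by omega
  have h3 : j + 2 + m + j = (j + 1 + m + j) + 1 := by ring
  have h4 : 2 * (j + 2 + m) = 2 * (j + 1 + m) + 1 + 1 := by ring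
  have f2 : (m + 2).factorial = (m + 2) * (m + 1).factorial := Nat.factorial_succ _
  have f3 : (j + 2 + m).factorial = (j + 2 + m) * (j + 1 + m).factorial := by
    rw [show j + 2 + m = (j + 1 + m) + 1 by ring, Nat.factorial_succ]
  have d1 : ((j + 1 + m : ℕ) : ℚ) - j = m + 1 := by push_cast; ring
  have d2 : ((j + 2 + m : ℕ) : ℚ) - j = m + 2 := by push_cast; ring
  rw [harmonicWeight, harmonicWeight, h1, h2, h3, h4, f2, f3, d1, d2, Nat.factorial_succ (j + 1 + m + j),
    Nat.factorial_succ (2 * (j + 1 + m) + 1), Nat.factorial_succ (2 * (j + 1 + m)), pow_succ]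
  have := Nat.factorial_ne_zero j
  have := Nat.factorial_ne_zero (m + 1)
  have := Nat.factorial_ne_zero (2 * (j + 1 + m))
  push_cast
  field_simp
  ring

theorem sum_harmonicWeight_sub (n J : ℕ) (hJ : J ≤ n) :
    ∑ j ∈ range J, (harmonicWeight (n + 1) j * (H2 (n + 1) - H2 j) -
        harmonicWeight n j * (H2 n - H2 j)) =
      harmonicWeight (n + 1) J * J ^ 2 * (3 * J - 5 * (n + 1)) / ((n + 1) ^ 2 * (n + 1 + J)) *
          (H2 n - H2 J) -
        harmonicWeight (n + 1) J * (4 * J ^ 2 - 8 * (n + 1) * J + 5 * (n + 1) ^ 2) / (n + 1) ^ 4 +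
        5 * harmonicWeight (n + 1) 0 / (n + 1) ^ 2 := by
  induction J with
  | zero => simp; field_simp; ring
  | succ J ih =>
    obtain ⟨m, rfl⟩ := Nat.exists_eq_add_of_le hJ
    rw [sum_range_succ, ih (by omega), show J + 1 + m + 1 = J + 2 + m by ring,
      harmonicWeight_succ_right, harmonicWeight_pred_left, H2_succ J,
      show J + 2 + m = J + 1 + m + 1 by ring, H2_succ (J + 1 + m)]
    push_cast
    generalize harmonicWeight (J + 1 + m + 1) J = κ
    generalize harmonicWeight (J + 1 + m + 1) 0 = κ₀
    generalize H2 (J + 1 + m) = h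
    generalize H2 J = h'
    field_simp
    ring

theorem sum_harmonicWeight_succ (n : ℕ) :
    ∑ j ∈ range (n + 1), harmonicWeight (n + 1) j * (H2 (n + 1) - H2 j) =
      ∑ j ∈ range n, harmonicWeight n j * (H2 n - H2 j) + 2 / ((n : ℚ) + 1) ^ 3 +
        5 * harmonicWeight (n + 1) 0 / (n + 1) ^ 2 := by
  have h := sum_harmonicWeight_sub n n le_rfl
  have e : harmonicWeight (n + 1) n = -(n + 1) / 2 := by
    rw [harmonicWeight, show n + 1 - n = 1 by omega, show 2 * (n + 1) = n + 1 + n + 1 by ring,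
      Nat.factorial_succ (n + 1 + n), Nat.factorial_succ n, show n + 1 + n = 2 * n + 1 by ring,
      pow_succ, pow_mul]
    have := Nat.factorial_ne_zero n
    have := Nat.factorial_ne_zero (2 * n + 1)
    push_cast
    field_simp
    simp
    ring
  rw [sum_sub_distrib, e] at h
  rw [sum_range_succ, eq_add_of_sub_eq h, H2_succ, e]
  field_simp
  ring

/-- The summand of a sum equal to that of the differences weighted by `harmonicWeight`. -/
def factorialTerm (n m : ℕ) : ℚ :=
  (-1) ^ (m + 1) * m.factorial ^ 2 * (n - 1 - m).factorial / ((m + 1) * (n + m + 1).factorial)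

theorem sum_factorialTerm_sub (n M : ℕ) (hM : M ≤ n) :
    ∑ m ∈ range M, (factorialTerm (n + 1) m - factorialTerm n m) =
      2 / ((n : ℚ) + 1) ^ 3 - 2 * (-1) ^ M * M.factorial ^ 2 * (n - M).factorial /
        ((n + 1 + M).factorial * (n + 1) ^ 2) := by
  induction M with
  | zero =>
    have := Nat.factorial_ne_zero n
    simp [Nat.factorial_succ]
    field_simp
    ring
  | succ M ih =>
    obtain ⟨s, rfl⟩ := Nat.exists_eq_add_of_le hM
    rw [sum_range_succ, ih (by omega), factorialTerm, factorialTerm,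
      show M + 1 + s - M = s + 1 by omega, show M + 1 + s + 1 - 1 - M = s + 1 by omega,
      show M + 1 + s - 1 - M = s by omega, show M + 1 + s - (M + 1) = s by omega,
      show M + 1 + s + 1 + (M + 1) = M + 1 + s + 1 + M + 1 by ring,
      show M + 1 + s + M + 1 = M + 1 + s + 1 + M by ring,
      Nat.factorial_succ (M + 1 + s + 1 + M), Nat.factorial_succ M, Nat.factorial_succ s, pow_succ]
    have := Nat.factorial_ne_zero M
    have := Nat.factorial_ne_zero s
    have := Nat.factorial_ne_zero (M + 1 + s + 1 + M)
    push_cast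
    field_simp
    ring

theorem sum_factorialTerm_succ (n : ℕ) :
    ∑ m ∈ range (n + 1), factorialTerm (n + 1) m =
      ∑ m ∈ range n, factorialTerm n m + 2 / ((n : ℚ) + 1) ^ 3 +
        5 * harmonicWeight (n + 1) 0 / (n + 1) ^ 2 := by
  have h := sum_factorialTerm_sub n n le_rfl
  rw [sum_sub_distrib] at h
  rw [sum_range_succ, eq_add_of_sub_eq h, factorialTerm, harmonicWeight, Nat.sub_zero, Nat.sub_self,
    show n + 1 - 1 - n = 0 by omega, show 2 * (n + 1) = n + 1 + n + 1 by ring,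
    Nat.factorial_succ (n + 1 + n), add_zero, Nat.factorial_succ n, pow_succ]
  have := Nat.factorial_ne_zero n
  have := Nat.factorial_ne_zero (n + 1 + n)
  push_cast
  field_simp
  ring

theorem sum_harmonicWeight_eq_sum_factorialTerm (n : ℕ) :
    ∑ j ∈ range n, harmonicWeight n j * (H2 n - H2 j) = ∑ m ∈ range n, factorialTerm n m := by
  induction n with
  | zero => simp
  | succ n ih => rw [sum_harmonicWeight_succ, sum_factorialTerm_succ, ih]

theorem rpoch_one_add_natCast (n m : ℕ) : rpoch (1 + n) m = (n + m).factorial / n.factorial := by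
  rw [eq_div_iff (by positivity), mul_comm, ← rpoch_one, ← rpoch_add, rpoch_one]

theorem harmonic_sum_add_factorial_sum (n : ℕ) :
    rpoch (-n) n / n.factorial ^ 2 * ∑ j ∈ range (n + 1),
        n.choose j * rpoch (-n) j * rpoch (1 + n) (n - j) / j *
          ∑ i ∈ range j, 1 / ((i : ℚ) - n) ^ 2 +
      ∑ j ∈ range n, j.factorial * rpoch (-(2 * n)) j / (((j : ℚ) - n) ^ 3 * rpoch (-n) j ^ 2) =
    0 := by
  have e1 : rpoch (-n) n / n.factorial ^ 2 * ∑ j ∈ range (n + 1),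
        n.choose j * rpoch (-n) j * rpoch (1 + n) (n - j) / j *
          ∑ i ∈ range j, 1 / ((i : ℚ) - n) ^ 2 = 
      (-1) ^ n * (2 * n).factorial / n.factorial ^ 2 *
        ∑ j ∈ range n, harmonicWeight n j * (H2 n - H2 j) := by
    rw [sum_range_succ']
    simp only [range_zero, sum_empty, mul_zero, add_zero]
    rw [← sum_range_reflect, mul_sum, mul_sum]
    refine sum_congr rfl fun j hj => ?_
    have hj := mem_range.1 hj
    rw [show n - 1 - j + 1 = n - j by omega, ← H2_sub_eq_sum (by omega)]
    obtain ⟨m, rfl⟩ := Nat.exists_eq_add_of_lt hj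
    rw [show j + m + 1 - j = m + 1 by omega, show j + m + 1 - (m + 1) = j by omega,
      rpoch_one_add_natCast, rpoch_neg_natCast le_rfl, rpoch_neg_natCast (by omega),
      show j + m + 1 - (m + 1) = j by omega, Nat.sub_self, harmonicWeight,
      show j + m + 1 - j = m + 1 by omega, Nat.choose_eq_factorial_div_factorial (by omega),
      show j + m + 1 - (m + 1) = j by omega, Nat.cast_div
      (by rw [show j + m + 1 = m + 1 + j by ring]; exact Nat.factorial_mul_factorial_dvd_factorial_add _ _)
      (by positivity)]
    have := Nat.factorial_ne_zero j
    have := Nat.factorial_ne_zero (m + 1)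
    have := Nat.factorial_ne_zero (j + m + 1)
    have := Nat.factorial_ne_zero (2 * (j + m + 1))
    have d : ((j + m + 1 : ℕ) : ℚ) - j = m + 1 := by push_cast; ring
    rw [d]
    have sgn : ((-1 : ℚ) ^ j) * (-1) ^ j = 1 := by rw [← mul_pow]; simp
    have e : ((-1 : ℚ)) ^ (m + 1) = (-1) ^ (j + m + 1 + j) := by
      rw [show j + m + 1 + j = (m + 1) + j + j by ring, pow_add _ _ j, pow_add _ _ j, mul_assoc, sgn,
        mul_one]
    rw [e]
    push_cast
    field_simp
    simp
  have e2 : ∑ j ∈ range n, j.factorial * rpoch (-(2 * n)) j / (((j : ℚ) - n) ^ 3 * rpoch (-n) j ^ 2) =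
      -((-1) ^ n * (2 * n).factorial / n.factorial ^ 2 * ∑ m ∈ range n, factorialTerm n m) := by
    rw [← sum_range_reflect, mul_sum, ← sum_neg_distrib]
    refine sum_congr rfl fun m hm => ?_
    obtain ⟨j, rfl⟩ := Nat.exists_eq_add_of_lt (mem_range.1 hm)
    have c : -(2 * ((m + j + 1 : ℕ) : ℚ)) = -((2 * (m + j + 1) : ℕ) : ℚ) := by push_cast; ring
    rw [show m + j + 1 - 1 - m = j by omega, c, rpoch_neg_natCast (by omega),
      rpoch_neg_natCast (by omega), factorialTerm, show m + j + 1 - 1 - m = j by omega,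
      show m + j + 1 - j = m + 1 by omega, show 2 * (m + j + 1) - j = m + j + 1 + m + 1 by omega,
      Nat.factorial_succ m]
    have d : (j : ℚ) - (m + j + 1 : ℕ) = -(m + 1) := by push_cast; ring
    rw [d]
    have := Nat.factorial_ne_zero j
    have := Nat.factorial_ne_zero m
    have := Nat.factorial_ne_zero (m + j + 1)
    have := Nat.factorial_ne_zero (m + j + 1 + m + 1)
    have sgn : ((-1 : ℚ) ^ m) * (-1) ^ m = 1 := by rw [← mul_pow]; simp
    have sgn' : ((-1 : ℚ) ^ j) * (-1) ^ j = 1 := by rw [← mul_pow]; simp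
    have e : ((-1 : ℚ)) ^ j = (-1) ^ (m + j + 1) * (-1) ^ (m + 1) := by
      rw [pow_succ, pow_succ, pow_add]; linear_combination -(-1) ^ j * sgn
    rw [div_pow, mul_pow (_ ^ _), pow_two (_ ^ j), sgn', e]
    push_cast
    field_simp
  rw [e1, e2, sum_harmonicWeight_eq_sum_factorialTerm]
  ring

/-- The ring of rational numbers whose denominator is prime to `p`. -/
def pIntegers (p : ℕ) [Fact p.Prime] : Subring ℚ where
  carrier := {q | padicNorm p q ≤ 1}
  mul_mem' {a b} ha hb := by
    change padicNorm p (a * b) ≤ 1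
    rw [padicNorm.mul]
    exact mul_le_one₀ ha (padicNorm.nonneg _) hb
  one_mem' := by simp
  add_mem' ha hb := padicNorm.nonarchimedean.trans (max_le ha hb)
  zero_mem' := by simp
  neg_mem' {a} ha := by simpa [padicNorm.neg] using ha

/-- `q ∈ p ^ e ℤ₍ₚ₎`. -/
def PDvd (p : ℕ) [Fact p.Prime] (e : ℕ) (q : ℚ) : Prop := ∃ r ∈ pIntegers p, q = p ^ e * r

/-- Congruence of `p`-integral rational numbers modulo `p`. -/
def ModEqP (p : ℕ) [Fact p.Prime] (a b : ℚ) : Prop :=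
  a ∈ pIntegers p ∧ b ∈ pIntegers p ∧ PDvd p 1 (a - b)

/-- `q` is a unit of `ℤ₍ₚ₎`. -/
def IsPUnit (p : ℕ) [Fact p.Prime] (q : ℚ) : Prop := padicNorm p q = 1

section
variable {p : ℕ} [Fact p.Prime] {a b c d q : ℚ} {e f : ℕ}

theorem IsPUnit.mem (h : IsPUnit p q) : q ∈ pIntegers p := le_of_eq h

theorem IsPUnit.ne_zero (h : IsPUnit p q) : q ≠ 0 := by
  rintro rfl; simp [IsPUnit] at h

theorem IsPUnit.mul (ha : IsPUnit p a) (hb : IsPUnit p b) : IsPUnit p (a * b) := by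
  simp only [IsPUnit, padicNorm.mul] at *; rw [ha, hb, one_mul]

theorem IsPUnit.inv (ha : IsPUnit p a) : IsPUnit p a⁻¹ := by
  have h : padicNorm p (a * a⁻¹) = 1 := by rw [mul_inv_cancel₀ ha.ne_zero]; simp
  rw [padicNorm.mul, show padicNorm p a = 1 from ha, one_mul] at h
  exact h

theorem IsPUnit.pow (ha : IsPUnit p a) (k : ℕ) : IsPUnit p (a ^ k) := by
  induction k with
  | zero => simp [IsPUnit]
  | succ k ih => rw [pow_succ]; exact ih.mul ha

theorem IsPUnit.prod {ι : Type*} {s : Finset ι} {g : ι → ℚ} (h : ∀ i ∈ s, IsPUnit p (g i)) :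
    IsPUnit p (∏ i ∈ s, g i) :=
  prod_induction g (IsPUnit p) (fun _ _ => IsPUnit.mul) (by simp [IsPUnit]) h

theorem IsPUnit.of_not_dvd {m : ℕ} (h : ¬ p ∣ m) : IsPUnit p (m : ℚ) :=
  padicNorm.nat_eq_one_iff m |>.2 h

theorem PDvd.of_mem (h : q ∈ pIntegers p) : PDvd p 0 q := ⟨q, h, by simp⟩

theorem PDvd.add (ha : PDvd p e a) (hb : PDvd p e b) : PDvd p e (a + b) := by
  obtain ⟨r, hr, rfl⟩ := ha
  obtain ⟨s, hs, rfl⟩ := hb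
  exact ⟨r + s, add_mem hr hs, by ring⟩

theorem PDvd.neg (ha : PDvd p e a) : PDvd p e (-a) := by
  obtain ⟨r, hr, rfl⟩ := ha
  exact ⟨-r, neg_mem hr, by ring⟩

theorem PDvd.sub (ha : PDvd p e a) (hb : PDvd p e b) : PDvd p e (a - b) := by
  rw [sub_eq_add_neg]; exact ha.add hb.neg

theorem PDvd.mul (ha : PDvd p e a) (hb : PDvd p f b) : PDvd p (e + f) (a * b) := by
  obtain ⟨r, hr, rfl⟩ := ha
  obtain ⟨s, hs, rfl⟩ := hb
  exact ⟨r * s, mul_mem hr hs, by ring⟩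

theorem PDvd.mul_integral (ha : PDvd p e a) (hb : b ∈ pIntegers p) : PDvd p e (a * b) :=
  ha.mul (PDvd.of_mem hb)

theorem PDvd.pow (ha : PDvd p 1 a) (k : ℕ) : PDvd p k (a ^ k) := by
  obtain ⟨r, hr, rfl⟩ := ha
  exact ⟨r ^ k, pow_mem hr k, by ring⟩

theorem PDvd.mono (ha : PDvd p e a) (h : f ≤ e) : PDvd p f a := by
  obtain ⟨r, hr, rfl⟩ := ha
  obtain ⟨m, rfl⟩ := Nat.exists_eq_add_of_le h
  exact ⟨p ^ m * r, mul_mem (pow_mem (natCast_mem _ p) m) hr, by ring⟩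

theorem PDvd.mem (ha : PDvd p e a) : a ∈ pIntegers p := by
  obtain ⟨r, hr, h⟩ := ha.mono (Nat.zero_le e)
  simpa [h] using hr

theorem PDvd.sum {ι : Type*} {s : Finset ι} {g : ι → ℚ} (h : ∀ i ∈ s, PDvd p e (g i)) :
    PDvd p e (∑ i ∈ s, g i) :=
  sum_induction g (PDvd p e) (fun _ _ => PDvd.add) ⟨0, zero_mem _, by simp⟩ h

theorem PDvd.padicNorm_lt_one (ha : PDvd p 1 a) : padicNorm p a < 1 := by
  obtain ⟨r, hr, rfl⟩ := ha
  rw [pow_one, padicNorm.mul]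
  have h1 : padicNorm p (p : ℚ) < 1 := padicNorm.padicNorm_p_lt_one_of_prime
  exact mul_lt_one_of_nonneg_of_lt_one_left (padicNorm.nonneg _) h1 hr

theorem IsPUnit.add_dvd (ha : IsPUnit p a) (hb : PDvd p 1 b) : IsPUnit p (a + b) := by
  have hb := hb.padicNorm_lt_one
  have ha' : padicNorm p a = 1 := ha
  rw [IsPUnit, padicNorm.add_eq_max_of_ne (by rw [ha']; exact hb.ne'), ha', max_eq_left hb.le]

theorem ModEqP.refl (h : a ∈ pIntegers p) : ModEqP p a a := ⟨h, h, 0, zero_mem _, by simp⟩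

theorem ModEqP.add (h : ModEqP p a b) (h' : ModEqP p c d) : ModEqP p (a + c) (b + d) :=
  ⟨add_mem h.1 h'.1, add_mem h.2.1 h'.2.1, by
    rw [add_sub_add_comm]; exact h.2.2.add h'.2.2⟩

theorem ModEqP.mul (h : ModEqP p a b) (h' : ModEqP p c d) : ModEqP p (a * c) (b * d) :=
  ⟨mul_mem h.1 h'.1, mul_mem h.2.1 h'.2.1, by
    rw [show a * c - b * d = (a - b) * c + (c - d) * b by ring]
    exact (h.2.2.mul_integral h'.1).add (h'.2.2.mul_integral h.2.1)⟩

theorem ModEqP.neg (h : ModEqP p a b) : ModEqP p (-a) (-b) :=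
  ⟨neg_mem h.1, neg_mem h.2.1, by rw [← neg_sub']; exact h.2.2.neg⟩

theorem ModEqP.sub (h : ModEqP p a b) (h' : ModEqP p c d) : ModEqP p (a - c) (b - d) := by
  rw [sub_eq_add_neg, sub_eq_add_neg]; exact h.add h'.neg

theorem ModEqP.pow (h : ModEqP p a b) (k : ℕ) : ModEqP p (a ^ k) (b ^ k) := by
  induction k with
  | zero => simpa using ModEqP.refl (one_mem _)
  | succ k ih => rw [pow_succ, pow_succ]; exact ih.mul h

theorem ModEqP.sum {ι : Type*} {s : Finset ι} {g g' : ι → ℚ}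
    (h : ∀ i ∈ s, ModEqP p (g i) (g' i)) : ModEqP p (∑ i ∈ s, g i) (∑ i ∈ s, g' i) :=
  ⟨sum_mem fun i hi => (h i hi).1, sum_mem fun i hi => (h i hi).2.1, by
    rw [← sum_sub_distrib]; exact PDvd.sum fun i hi => (h i hi).2.2⟩

theorem ModEqP.prod {ι : Type*} {s : Finset ι} {g g' : ι → ℚ}
    (h : ∀ i ∈ s, ModEqP p (g i) (g' i)) : ModEqP p (∏ i ∈ s, g i) (∏ i ∈ s, g' i) := by
  classical
  induction s using Finset.induction_on with
  | empty => simpa using ModEqP.refl (one_mem _)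
  | insert i s hi ih =>
    rw [prod_insert hi, prod_insert hi]
    exact (h i (mem_insert_self i s)).mul (ih fun j hj => h j (mem_insert_of_mem hj))

theorem ModEqP.punit (h : ModEqP p a b) (ha : IsPUnit p a) : IsPUnit p b := by
  have := ha.add_dvd h.2.2.neg
  rwa [neg_sub, add_sub_cancel] at this

theorem ModEqP.inv (h : ModEqP p a b) (ha : IsPUnit p a) : ModEqP p a⁻¹ b⁻¹ := by
  have hb := h.punit ha
  refine ⟨ha.inv.mem, hb.inv.mem, ?_⟩
  rw [show a⁻¹ - b⁻¹ = -((a - b) * (a⁻¹ * b⁻¹)) by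
    have := ha.ne_zero
    have := hb.ne_zero
    field_simp; ring]
  exact (h.2.2.mul_integral (mul_mem ha.inv.mem hb.inv.mem)).neg

theorem ModEqP.div (h : ModEqP p a b) (h' : ModEqP p c d) (hc : IsPUnit p c) :
    ModEqP p (a / c) (b / d) := by
  rw [div_eq_mul_inv, div_eq_mul_inv]; exact h.mul (h'.inv hc)

theorem ModEqP.of_sub_eq (ha : a ∈ pIntegers p) (h : PDvd p 1 (a - b)) : ModEqP p a b :=
  ⟨ha, by simpa using sub_mem ha h.mem, h⟩

theorem ModEqP.rpoch (h : ModEqP p a b) (k : ℕ) : ModEqP p (rpoch a k) (rpoch b k) := by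
  rw [rpoch_eq_prod, rpoch_eq_prod]
  exact ModEqP.prod fun i _ => h.add (ModEqP.refl (natCast_mem _ i))

/-- First-order expansion of a product of factors close to `1`. -/
theorem exists_prod_one_sub_mul (P : ℚ) (hP : P ∈ pIntegers p) (w : ℕ → ℚ) (k : ℕ)
    (hw : ∀ i < k, w i ∈ pIntegers p) :
    ∃ g ∈ pIntegers p, ∏ i ∈ range k, (1 - P * w i) = 1 - P * ∑ i ∈ range k, w i + P ^ 2 * g := by
  induction k with
  | zero => exact ⟨0, zero_mem _, by simp⟩
  | succ k ih =>
    obtain ⟨g, hg, e⟩ := ih fun i hi => hw i (by omega)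
    have hk := hw k (by omega)
    have hs : ∑ i ∈ range k, w i ∈ pIntegers p :=
      sum_mem fun i hi => hw i (by have := mem_range.1 hi; omega)
    refine ⟨g + (∑ i ∈ range k, w i) * w k - P * g * w k,
      sub_mem (add_mem hg (mul_mem hs hk)) (mul_mem (mul_mem hP hg) hk), ?_⟩
    rw [prod_range_succ, e, sum_range_succ]
    ring

theorem PDvd.ratCongr (h : PDvd p e (a - b)) :
    ratCongr a b p e := by
  obtain ⟨r, hr, h⟩ := h
  refine ⟨r.num, r.den, ?_, ?_⟩
  · intro hd
    have hd' : p ∣ r.den := by exact_mod_cast hd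
    have hn : ¬ p ∣ r.num.natAbs := fun hn =>
      (Fact.out : p.Prime).one_lt.ne' (Nat.dvd_one.1 (r.reduced ▸ Nat.dvd_gcd hn hd'))
    have h1 : padicNorm p (r.num : ℚ) = 1 :=
      (padicNorm.int_eq_one_iff _).2 fun hh => hn (Int.natCast_dvd.1 hh)
    have h2 : padicNorm p (r.den : ℚ) < 1 := (padicNorm.nat_lt_one_iff _).2 hd'
    have h3 : padicNorm p (r * r.den) = 1 := by rw [Rat.mul_den_eq_num]; exact h1
    rw [padicNorm.mul] at h3
    have h4 := mul_lt_one_of_nonneg_of_lt_one_right (show padicNorm p r ≤ 1 from hr)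
      (padicNorm.nonneg _) h2
    exact h4.ne h3
  · rw [h, mul_assoc]
    congr 1
    exact_mod_cast Rat.mul_den_eq_num r
end

/-- The setting `x = a + n ≡ 0 (mod p)`, in which no denominator is divisible by `p`. -/
structure Admissible (p : ℕ) [Fact p.Prime] (a x : ℚ) (n : ℕ) : Prop where
  eq_add : x = a + n
  dvd : PDvd p 1 x
  unit_add : ∀ i < n, IsPUnit p (a + i)
  unit_nat : ∀ i < n, IsPUnit p (1 + i)
  pos : 0 < a
  ne_nat : ∀ i : ℕ, x - i ≠ 0

/-- The coefficients `(a - y)_k (a + y)_k / ((1 + y)_k (1 - y)_k)`. -/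
noncomputable def poisedCoeff (a y : ℚ) (k : ℕ) : ℚ :=
  rpoch (a - y) k * rpoch (a + y) k / (rpoch (1 + y) k * rpoch (1 - y) k)

theorem poisedCoeff_zero (a : ℚ) (k : ℕ) :
    poisedCoeff a 0 k = (rpoch a k / k.factorial) ^ 2 := by
  simp [poisedCoeff, rpoch_one, pow_two, mul_div_mul_comm]

theorem rpoch_sub_mul_rpoch_add {u : ℚ} (y : ℚ) {k : ℕ} (hu : ∀ i < k, u + i ≠ 0) :
    rpoch (u - y) k * rpoch (u + y) k =
      rpoch u k ^ 2 * ∏ i ∈ range k, (1 - y ^ 2 * (1 / (u + i) ^ 2)) := by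
  rw [rpoch_eq_prod, rpoch_eq_prod, rpoch_eq_prod, ← prod_mul_distrib, ← prod_pow,
    ← prod_mul_distrib]
  refine prod_congr rfl fun i hi => ?_
  have := hu i (mem_range.1 hi)
  field_simp
  ring

theorem H2_eq_sum_range (k : ℕ) : H2 k = ∑ i ∈ range k, 1 / (1 + (i : ℚ)) ^ 2 := by
  induction k with
  | zero => simp [H2_zero]
  | succ k ih => rw [H2_succ, sum_range_succ, ih, add_comm (k : ℚ)]

/-- The value modulo `p` of `(poisedCoeff a 0 k - poisedCoeff a x k) / x ^ 2`. -/
def binomDiff (n k : ℕ) : ℚ := (n.choose k : ℚ) ^ 2 * (H2 n - H2 (n - k) - H2 k)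

theorem binomDiff_symm {n k : ℕ} (h : k ≤ n) : binomDiff n (n - k) = binomDiff n k := by
  rw [binomDiff, binomDiff, Nat.choose_symm h, Nat.sub_sub_self h]; ring

theorem sum_mul_binomDiff_sq (n : ℕ) :
    ∑ k ∈ range (n + 1), (-(n : ℚ) + 2 * k) * binomDiff n k ^ 2 = 0 := by
  have h := sum_range_reflect (fun k : ℕ => (-(n : ℚ) + 2 * k) * binomDiff n k ^ 2) (n + 1)
  have h' : ∑ k ∈ range (n + 1), (-(n : ℚ) + 2 * (n + 1 - 1 - k : ℕ)) *
      binomDiff n (n + 1 - 1 - k) ^ 2 = -∑ k ∈ range (n + 1), (-(n : ℚ) + 2 * k) * binomDiff n k ^ 2 := by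
    rw [← sum_neg_distrib]
    refine sum_congr rfl fun k hk => ?_
    have hk : k ≤ n := Nat.lt_succ_iff.1 (mem_range.1 hk)
    rw [Nat.add_sub_cancel, binomDiff_symm hk, Nat.cast_sub hk]
    ring
  rw [h'] at h
  linarith

namespace Admissible
variable {p : ℕ} [Fact p.Prime] {a x : ℚ} {n : ℕ}

theorem modEq_neg (H : Admissible p a x n) : ModEqP p a (-n) := by
  have e : a = x - n := by rw [H.eq_add]; ring
  refine .of_sub_eq ?_ ?_
  · rw [e]; exact sub_mem H.dvd.mem (natCast_mem _ n)
  · rw [e, show x - n - -n = x by ring]; exact H.dvd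

theorem modEq_zero (H : Admissible p a x n) : ModEqP p x 0 :=
  .of_sub_eq H.dvd.mem (by simpa using H.dvd)

theorem unit_factorial (H : Admissible p a x n) {k : ℕ} (hk : k ≤ n) :
    IsPUnit p (k.factorial : ℚ) := by
  rw [← rpoch_one, rpoch_eq_prod]
  exact .prod fun i hi => H.unit_nat i (by have := mem_range.1 hi; omega)

theorem modEq_sum_inv_sq (H : Admissible p a x n) {k : ℕ} (hk : k ≤ n) :
    ModEqP p (∑ i ∈ range k, 1 / (a + i) ^ 2) (∑ i ∈ range k, 1 / ((i : ℚ) - n) ^ 2) := by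
  refine .sum fun i hi => ?_
  refine .div (.refl (one_mem _)) (.pow ?_ 2) (.pow (H.unit_add i (by have := mem_range.1 hi; omega)) 2)
  rw [show (i : ℚ) - n = -n + i by ring]
  exact H.modEq_neg.add (.refl (natCast_mem _ i))

theorem H2_mem (H : Admissible p a x n) {k : ℕ} (hk : k ≤ n) : H2 k ∈ pIntegers p := by
  rw [H2_eq_sum_range]
  refine sum_mem fun i hi => ?_
  rw [one_div]
  exact ((H.unit_nat i (by have := mem_range.1 hi; omega)).pow 2).inv.mem

theorem exists_prod_add (H : Admissible p a x n) {k : ℕ} (hk : k ≤ n) :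
    ∃ g ∈ pIntegers p, ∏ i ∈ range k, (1 - x ^ 2 * (1 / (a + i) ^ 2)) =
      1 - x ^ 2 * ∑ i ∈ range k, 1 / (a + i) ^ 2 + (x ^ 2) ^ 2 * g := by
  refine exists_prod_one_sub_mul _ (pow_mem H.dvd.mem 2) _ k fun i hi => ?_
  rw [one_div]
  exact ((H.unit_add i (by omega)).pow 2).inv.mem

theorem exists_prod_nat (H : Admissible p a x n) {k : ℕ} (hk : k ≤ n) :
    ∃ g ∈ pIntegers p, ∏ i ∈ range k, (1 - x ^ 2 * (1 / (1 + (i : ℚ)) ^ 2)) =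
      1 - x ^ 2 * H2 k + (x ^ 2) ^ 2 * g := by
  rw [H2_eq_sum_range]
  refine exists_prod_one_sub_mul _ (pow_mem H.dvd.mem 2) _ k fun i hi => ?_
  rw [one_div]
  exact ((H.unit_nat i (by omega)).pow 2).inv.mem

theorem modEq_sub_mul (H : Admissible p a x n) {u v g : ℚ} (h : ModEqP p u v)
    (hg : g ∈ pIntegers p) : ModEqP p (u - x ^ 2 * g) v := by
  simpa using h.sub ((H.modEq_zero.pow 2).mul (.refl hg))

theorem exists_poisedCoeff_sub (H : Admissible p a x n) {k : ℕ} (hk : k ≤ n) :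
    ∃ d, ModEqP p d (binomDiff n k) ∧ poisedCoeff a 0 k - poisedCoeff a x k = x ^ 2 * d := by
  obtain ⟨g, hg, eg⟩ := H.exists_prod_add hk
  obtain ⟨f, hf, ef⟩ := H.exists_prod_nat hk
  have hfac := H.unit_factorial hk
  have hunit : IsPUnit p (1 - x ^ 2 * (H2 k - x ^ 2 * f)) := by
    have h1 : IsPUnit p (1 : ℚ) := by simp [IsPUnit]
    rw [sub_eq_add_neg]
    refine h1.add_dvd (PDvd.neg ?_)
    exact ((H.dvd.pow 2).mono (by omega)).mul_integral
      (sub_mem (H.H2_mem hk) (mul_mem (pow_mem H.dvd.mem 2) hf))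
  refine ⟨(rpoch a k / k.factorial) ^ 2 * ((∑ i ∈ range k, 1 / (a + i) ^ 2 - x ^ 2 * g) -
    (H2 k - x ^ 2 * f)) / (1 - x ^ 2 * (H2 k - x ^ 2 * f)), ?_, ?_⟩
  · have e : binomDiff n k = (rpoch (-n) k / k.factorial) ^ 2 *
        (∑ i ∈ range k, 1 / ((i : ℚ) - n) ^ 2 - H2 k) / 1 := by
      have e1 : (rpoch (-n) k / k.factorial) ^ 2 = (n.choose k : ℚ) ^ 2 := by
        rw [rpoch_neg_natCast hk, Nat.choose_eq_factorial_div_factorial hk, Nat.cast_div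
          (Nat.factorial_mul_factorial_dvd_factorial hk) (by positivity)]
        simp only [div_pow, mul_pow, ← pow_mul, mul_comm k 2]
        rw [pow_mul]
        have := Nat.factorial_ne_zero k
        have := Nat.factorial_ne_zero (n - k)
        push_cast
        field_simp
        simp
      rw [e1, ← H2_sub_eq_sum hk, binomDiff, div_one]
    rw [e]
    refine .div (.mul (.pow (.div (H.modEq_neg.rpoch k) (.refl hfac.mem) hfac) 2)
      (.sub (H.modEq_sub_mul (H.modEq_sum_inv_sq hk) hg)
        (H.modEq_sub_mul (.refl (H.H2_mem hk)) hf))) ?_ hunit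
    exact H.modEq_sub_mul (.refl (one_mem _))
      (sub_mem (H.H2_mem hk) (mul_mem (pow_mem H.dvd.mem 2) hf))
  · have q1 := hunit.ne_zero
    have q2 := hfac.ne_zero
    rw [poisedCoeff_zero, poisedCoeff, rpoch_sub_mul_rpoch_add x
      (fun i hi => (H.unit_add i (by omega)).ne_zero), mul_comm (rpoch (1 + x) k),
      rpoch_sub_mul_rpoch_add x (fun i hi => (H.unit_nat i (by omega)).ne_zero), eg, ef, rpoch_one,
      show 1 - x ^ 2 * H2 k + (x ^ 2) ^ 2 * f = 1 - x ^ 2 * (H2 k - x ^ 2 * f) by ring]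
    field_simp
    ring

theorem pDvd_sum_sub_sq (H : Admissible p a x n) :
    PDvd p 5 (∑ k ∈ range (n + 1), (a + 2 * k) * (poisedCoeff a 0 k - poisedCoeff a x k) ^ 2) := by
  have h : ∀ k : ℕ, ∃ d, k ≤ n → ModEqP p d (binomDiff n k) ∧
      poisedCoeff a 0 k - poisedCoeff a x k = x ^ 2 * d := fun k => by
    by_cases hk : k ≤ n
    · obtain ⟨d, hd⟩ := H.exists_poisedCoeff_sub hk
      exact ⟨d, fun _ => hd⟩
    · exact ⟨0, fun h => absurd h hk⟩
  choose d hd using h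
  have e : ∑ k ∈ range (n + 1), (a + 2 * k) * (poisedCoeff a 0 k - poisedCoeff a x k) ^ 2 =
      x ^ 4 * ∑ k ∈ range (n + 1), (a + 2 * k) * d k ^ 2 := by
    rw [mul_sum]
    refine sum_congr rfl fun k hk => ?_
    rw [(hd k (Nat.lt_succ_iff.1 (mem_range.1 hk))).2]
    ring
  have hm : ModEqP p (∑ k ∈ range (n + 1), (a + 2 * k) * d k ^ 2)
      (∑ k ∈ range (n + 1), (-(n : ℚ) + 2 * k) * binomDiff n k ^ 2) :=
    .sum fun k hk => .mul (.add H.modEq_neg (.refl (mul_mem (ofNat_mem _ 2) (natCast_mem _ k))))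
      (.pow (hd k (Nat.lt_succ_iff.1 (mem_range.1 hk))).1 2)
  rw [sum_mul_binomDiff_sq] at hm
  rw [e]
  exact (H.dvd.pow 4).mul (by simpa using hm.2.2)

theorem one_sub_ne (H : Admissible p a x n) (i : ℕ) : 1 - x + i ≠ 0 := fun h =>
  H.ne_nat (i + 1) (by push_cast; linarith)

theorem x_pos (H : Admissible p a x n) : 0 < x := by
  rw [H.eq_add]; exact add_pos_of_pos_of_nonneg H.pos (Nat.cast_nonneg n)

theorem sum_poisedCoeff_zero_mul (H : Admissible p a x n) :
    ∑ k ∈ range (n + 1), (a + 2 * k) * (poisedCoeff a 0 k * poisedCoeff a x k) =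
      x * rpoch (2 * a) n / n.factorial := by
  have h := sum_very_well_poised a a (a + x) H.pos (fun i => by ring_nf; positivity)
    (fun i => by have := H.one_sub_ne i; ring_nf at this ⊢; exact this) n
  have e1 : -(n : ℚ) = a - x := by rw [H.eq_add]; ring
  have e2 : 1 + a - a = 1 := by ring
  have e3 : 1 + a - (a + x) = 1 - x := by ring
  have e4 : 1 + a + n = 1 + x := by rw [H.eq_add]; ring
  have e5 : 1 - (a + x) = 1 - 2 * a - n := by rw [H.eq_add]; ring
  have e6 : 1 - x = 1 - a - n := by rw [H.eq_add]; ring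
  have q := rpoch_ne_zero (fun i => H.one_sub_ne i) n
  have r1 := rpoch_reflect (2 * a) n
  have r2 := rpoch_reflect a n
  rw [← e5] at r1
  rw [← e6] at r2
  have hfac := Nat.factorial_ne_zero n
  rw [e2, e3, e4, e5, ← e5, rpoch_succ, ← H.eq_add, rpoch_one, r2] at h
  rw [r1]
  convert h using 1
  · refine sum_congr rfl fun k _ => ?_
    rw [poisedCoeff_zero, poisedCoeff, ← e1, rpoch_one]
    ring
  · field_simp

theorem sum_poisedCoeff_mul (H : Admissible p a x n) (y : ℚ) (hy : ∀ i : ℕ, 1 - y + i ≠ 0)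
    (hy' : ∀ i : ℕ, 1 + y + i ≠ 0) :
    ∑ k ∈ range (n + 1), (a + 2 * k) * (poisedCoeff a y k * poisedCoeff a x k) =
      rpoch a (n + 1) / (rpoch (1 - y) n * rpoch (1 + y) n) *
        ∑ j ∈ range (n + 1), x / (x - j) * n.choose j * (rpoch (a + y) j * rpoch (a - y) j / rpoch a j) *
          rpoch (1 - a) (n - j) := by
  have c1 : 1 + a - (a + y) = 1 - y := by ring
  have c2 : 1 + a - (a - y) = 1 + y := by ring
  have h := whipple_transform a (a + y) (a - y) x n H.pos H.ne_nat
    (fun i => by rw [c1]; exact hy i) (fun i => by rw [c2]; exact hy' i)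
  have c3 : 1 - y - (a - y) = 1 - a := by ring
  have c4 : -(n : ℚ) = a - x := by rw [H.eq_add]; ring
  have c5 : 1 + a + n = 1 + x := by rw [H.eq_add]; ring
  rw [c1, c2, c3, c4, c5] at h
  rw [← h]
  refine sum_congr rfl fun k _ => ?_
  rw [poisedCoeff, poisedCoeff]
  ring

theorem exists_sum_poisedCoeff_sq (H : Admissible p a x n) :
    ∃ l, ModEqP p l (rpoch (-n) n / n.factorial ^ 2 * ∑ j ∈ range (n + 1),
        n.choose j * rpoch (-n) j * rpoch (1 + n) (n - j) / j *
          ∑ i ∈ range j, 1 / ((i : ℚ) - n) ^ 2) ∧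
      rpoch (1 - x) n * rpoch (1 + x) n / n.factorial ^ 2 *
        ∑ k ∈ range (n + 1), (a + 2 * k) * (poisedCoeff a x k * poisedCoeff a x k) =
      ∑ k ∈ range (n + 1), (a + 2 * k) * (poisedCoeff a 0 k * poisedCoeff a x k) + x ^ 4 * l := by
  have h : ∀ k : ℕ, ∃ g ∈ pIntegers p, k ≤ n → ∏ i ∈ range k, (1 - x ^ 2 * (1 / (a + i) ^ 2)) =
      1 - x ^ 2 * ∑ i ∈ range k, 1 / (a + i) ^ 2 + (x ^ 2) ^ 2 * g := fun k => by
    by_cases hk : k ≤ n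
    · obtain ⟨g, hg, e⟩ := H.exists_prod_add hk
      exact ⟨g, hg, fun _ => e⟩
    · exact ⟨0, zero_mem _, fun h => absurd h hk⟩
  choose g hg eg using h
  have hfac := H.unit_factorial le_rfl
  refine ⟨rpoch a n / n.factorial ^ 2 * ∑ j ∈ range n, n.choose (j + 1) * rpoch a (j + 1) *
    rpoch (1 - a) (n - (j + 1)) / (1 + j - x) *
      (∑ i ∈ range (j + 1), 1 / (a + i) ^ 2 - x ^ 2 * g (j + 1)), ?_, ?_⟩
  · rw [sum_range_succ']
    simp only [range_zero, sum_empty, mul_zero, add_zero]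
    refine .mul (.div (H.modEq_neg.rpoch n) (.refl (pow_mem hfac.mem 2)) (hfac.pow 2))
      (.sum fun j hj => ?_)
    have hj := mem_range.1 hj
    have hd := (H.unit_nat j hj).add_dvd H.dvd.neg
    rw [← sub_eq_add_neg] at hd
    refine .mul (.div (.mul (.mul (.refl (natCast_mem _ _)) (H.modEq_neg.rpoch _)) ?_) ?_ hd)
      (H.modEq_sub_mul (H.modEq_sum_inv_sq hj) (hg _))
    · have := (ModEqP.refl (one_mem (pIntegers p))).sub H.modEq_neg
      rw [sub_neg_eq_add] at this
      exact this.rpoch _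
    · have := (ModEqP.refl (H.unit_nat j hj).mem).sub H.modEq_zero
      rw [sub_zero] at this
      push_cast
      rwa [add_comm (j : ℚ)]
  · have hx := H.x_pos
    have q1 := rpoch_ne_zero (fun i => H.one_sub_ne i) n
    have q2 := rpoch_ne_zero (a := 1 + x) (fun i => by positivity) n
    have q3 := hfac.ne_zero
    rw [H.sum_poisedCoeff_mul x (fun i => H.one_sub_ne i) (fun i => by positivity),
      H.sum_poisedCoeff_mul 0 (fun i => by positivity) (fun i => by positivity)]
    have e : ∀ j ∈ range (n + 1), x / (x - j) * n.choose j *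
        (rpoch (a + x) j * rpoch (a - x) j / rpoch a j) * rpoch (1 - a) (n - j) =
        x / (x - j) * n.choose j * (rpoch (a + 0) j * rpoch (a - 0) j / rpoch a j) *
          rpoch (1 - a) (n - j) +
        x ^ 3 * (if j = 0 then 0 else n.choose j * rpoch a j * rpoch (1 - a) (n - j) / (j - x) *
          (∑ i ∈ range j, 1 / (a + i) ^ 2 - x ^ 2 * g j)) := fun j hj => by
      have hj := Nat.lt_succ_iff.1 (mem_range.1 hj)
      rcases Nat.eq_zero_or_pos j with rfl | h0
      · simp
      have q4 := rpoch_ne_zero (a := a) (fun i => by have := H.pos; positivity) j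
      have q5 := H.ne_nat j
      have q6 : (j : ℚ) - x ≠ 0 := fun h => q5 (by linarith)
      rw [mul_comm (rpoch (a + x) j), rpoch_sub_mul_rpoch_add x
        (fun i hi => (H.unit_add i (by omega)).ne_zero), eg j hj, if_neg h0.ne', add_zero, sub_zero]
      have q7 : x / (x - j) = -(x / (j - x)) := by rw [← neg_sub, div_neg]
      rw [q7]
      field_simp
      ring
    rw [sum_congr rfl e, sum_add_distrib, ← mul_sum, sum_range_succ' (fun j => ite (j = 0) _ _)]
    simp only [if_true, add_zero, sub_zero, rpoch_one, Nat.succ_ne_zero, if_false]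
    rw [rpoch_succ, ← H.eq_add]
    push_cast
    simp only [add_comm _ (1 : ℚ)]
    field_simp

theorem pDvd_sum_sub (H : Admissible p a x n) :
    PDvd p 5 (∑ k ∈ range (n + 1), (a + 2 * k) * (rpoch a k / k.factorial) ^ 4 -
      (x * rpoch (2 * a) n / n.factorial * (1 - x ^ 2 * H2 n) +
        x ^ 4 * ∑ j ∈ range n, j.factorial * rpoch (2 * a) j / ((a + j) ^ 3 * rpoch a j ^ 2))) := by
  obtain ⟨l, hl, el⟩ := H.exists_sum_poisedCoeff_sq
  obtain ⟨g, hg, eg⟩ := H.exists_prod_nat le_rfl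
  have hfac := H.unit_factorial le_rfl
  have h2a : ModEqP p (2 * a) (-(2 * n)) := by
    rw [show -(2 * (n : ℚ)) = 2 * -n by ring]
    exact (ModEqP.refl (ofNat_mem _ 2)).mul H.modEq_neg
  have hT : ModEqP p
      (∑ j ∈ range n, j.factorial * rpoch (2 * a) j / ((a + j) ^ 3 * rpoch a j ^ 2))
      (∑ j ∈ range n, j.factorial * rpoch (-(2 * n)) j / (((j : ℚ) - n) ^ 3 * rpoch (-n) j ^ 2)) := by
    refine .sum fun j hj => ?_
    have hj := mem_range.1 hj
    have hu : IsPUnit p (rpoch a j) := by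
      rw [rpoch_eq_prod]
      exact .prod fun i hi => H.unit_add i (by have := mem_range.1 hi; omega)
    refine .div (.mul (.refl (natCast_mem _ _)) (h2a.rpoch j)) (.mul (.pow ?_ 3)
      (.pow (H.modEq_neg.rpoch j) 2)) (((H.unit_add j hj).pow 3).mul (hu.pow 2))
    rw [sub_eq_neg_add]
    exact H.modEq_neg.add (.refl (natCast_mem _ j))
  have hlT := hl.add hT
  rw [harmonic_sum_add_factorial_sum] at hlT
  generalize ∑ j ∈ range n, (j.factorial : ℚ) * rpoch (2 * a) j / ((a + j) ^ 3 * rpoch a j ^ 2) = T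
    at hlT ⊢
  have eQ : rpoch (1 - x) n * rpoch (1 + x) n / n.factorial ^ 2 =
      1 - x ^ 2 * H2 n + (x ^ 2) ^ 2 * g := by
    have := hfac.ne_zero
    rw [rpoch_sub_mul_rpoch_add x (fun i hi => (H.unit_nat i hi).ne_zero), eg, rpoch_one]
    field_simp
  have hH := H.H2_mem le_rfl
  have hQ : IsPUnit p (1 - x ^ 2 * H2 n + (x ^ 2) ^ 2 * g) := by
    have h1 : IsPUnit p (1 : ℚ) := by simp [IsPUnit]
    rw [show 1 - x ^ 2 * H2 n + (x ^ 2) ^ 2 * g = 1 + -(x ^ 2 * (H2 n - x ^ 2 * g)) by ring]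
    exact h1.add_dvd (((H.dvd.pow 2).mono (by omega)).mul_integral
      (sub_mem hH (mul_mem (pow_mem H.dvd.mem 2) hg))).neg
  have hsq := H.pDvd_sum_sub_sq
  have e0 : ∑ k ∈ range (n + 1), (a + 2 * k) * (rpoch a k / k.factorial) ^ 4 =
      ∑ k ∈ range (n + 1), (a + 2 * k) * (poisedCoeff a 0 k - poisedCoeff a x k) ^ 2 +
      2 * ∑ k ∈ range (n + 1), (a + 2 * k) * (poisedCoeff a 0 k * poisedCoeff a x k) -
      ∑ k ∈ range (n + 1), (a + 2 * k) * (poisedCoeff a x k * poisedCoeff a x k) := by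
    rw [mul_sum, ← sum_add_distrib, ← sum_sub_distrib]
    refine sum_congr rfl fun k _ => ?_
    rw [poisedCoeff_zero]
    ring
  rw [eQ] at el
  rw [e0]
  rw [H.sum_poisedCoeff_zero_mul] at el ⊢
  generalize ∑ k ∈ range (n + 1), (a + 2 * k) * (poisedCoeff a 0 k - poisedCoeff a x k) ^ 2 = D
    at hsq ⊢
  generalize ∑ k ∈ range (n + 1), (a + 2 * k) * (poisedCoeff a x k * poisedCoeff a x k) = S
    at el ⊢
  have hc : rpoch (2 * a) n / n.factorial ∈ pIntegers p := by
    rw [div_eq_mul_inv]; exact mul_mem (h2a.rpoch n).1 hfac.inv.mem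
  rw [mul_div_assoc] at el ⊢
  generalize rpoch (2 * a) n / (n.factorial : ℚ) = c at el hc ⊢
  generalize H2 n = h at el hH hQ ⊢
  have key : D + 2 * (x * c) - S - (x * c * (1 - x ^ 2 * h) + x ^ 4 * T) =
      D - x ^ 4 * (l + T) + x ^ 5 * ((c * (g + x ^ 2 * h * g - h ^ 2) + x * l * (-h + x ^ 2 * g)) *
        (1 - x ^ 2 * h + (x ^ 2) ^ 2 * g)⁻¹) := by
    have h1 := mul_inv_cancel₀ hQ.ne_zero
    have eS : S = (x * c + x ^ 4 * l) * (1 - x ^ 2 * h + (x ^ 2) ^ 2 * g)⁻¹ := by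
      rw [eq_mul_inv_iff_mul_eq₀ hQ.ne_zero, mul_comm, el]
    rw [eS]
    generalize (1 - x ^ 2 * h + (x ^ 2) ^ 2 * g)⁻¹ = q at h1
    linear_combination -(x * c * (1 + x ^ 2 * h) + x ^ 4 * l) * h1
  rw [key]
  have hx := H.dvd.mem
  refine (hsq.sub ((H.dvd.pow 4).mul (f := 1) ?_)).add ((H.dvd.pow 5).mul_integral (mul_mem ?_ hQ.inv.mem))
  · simpa using hlT.2.2
  · exact add_mem (mul_mem hc (sub_mem (add_mem hg (mul_mem (mul_mem (pow_mem hx 2) hH) hg))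
      (pow_mem hH 2))) (mul_mem (mul_mem hx hl.1) (add_mem (neg_mem hH) (mul_mem (pow_mem hx 2) hg)))

end Admissible

theorem admissible_quarter {p : ℕ} [Fact p.Prime] (hp3 : p % 4 = 3) :
    Admissible p (1 / 4) (3 * p / 4) ((3 * p - 1) / 4) := by
  obtain ⟨m, hm⟩ : ∃ m, p = 4 * m + 3 := ⟨p / 4, by omega⟩
  have hn : (3 * p - 1) / 4 = 3 * m + 2 := by omega
  have two : ¬ p ∣ 4 := fun h => by
    have := Nat.le_of_dvd (by omega) h
    have : p = 3 := by omega
    subst this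
    omega
  have h4 : IsPUnit p (4 : ℚ) := by exact_mod_cast IsPUnit.of_not_dvd two
  have hpm : (p : ℚ) = 4 * m + 3 := by exact_mod_cast hm
  rw [hn]
  refine ⟨by rw [hpm]; push_cast; ring, ⟨3 / 4, ?_, by ring⟩, fun i hi => ?_, fun i hi => ?_,
    by norm_num, fun i h => ?_⟩
  · rw [div_eq_mul_inv]; exact mul_mem (ofNat_mem _ 3) h4.inv.mem
  · have hd : ¬ p ∣ 4 * i + 1 := by
      rintro ⟨t, ht⟩
      have : t < 3 := by nlinarith
      interval_cases t <;> omega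
    rw [show (1 / 4 + i : ℚ) = ((4 * i + 1 : ℕ) : ℚ) * 4⁻¹ by push_cast; ring]
    exact (IsPUnit.of_not_dvd hd).mul h4.inv
  · have hd : ¬ p ∣ 1 + i := fun h => by
      have := Nat.le_of_dvd (by omega) h
      omega
    exact_mod_cast IsPUnit.of_not_dvd hd
  · have : 3 * p = 4 * i := by
      have : (3 * p : ℚ) = 4 * i := by linarith
      exact_mod_cast this
    omega

/-- Corollary 1.5, case `M = (3p-1)/4`: for primes `p ≡ 3 (mod 4)`, modulo `p^5`. -/
theorem stmt13 (p : ℕ) (hp : p.Prime) (hp3 : p % 4 = 3) :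
    ratCongr
      (∑ k ∈ Finset.range ((3 * p - 1) / 4 + 1),
        (8 * (k : ℚ) + 1) * (rpoch (1 / 4) k) ^ 4 / ((k.factorial : ℚ)) ^ 4)
      (rpoch (1 / 2) ((3 * p - 1) / 4) / rpoch 1 ((3 * p - 1) / 4) *
        (3 * (p : ℚ) - 27 * (p : ℚ) ^ 3 / 16 * H2 ((3 * p - 1) / 4)) +
       81 * (p : ℚ) ^ 4 *
        ∑ k ∈ Finset.Icc 1 ((3 * p - 1) / 4),
          rpoch 1 (k - 1) * rpoch (1 / 2) (k - 1) /
            ((4 * (k : ℚ) - 3) ^ 3 * (rpoch (1 / 4) (k - 1)) ^ 2))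
      p 5 := by
  have : Fact p.Prime := ⟨hp⟩
  have H := (admissible_quarter (p := p) hp3).pDvd_sum_sub
  generalize (3 * p - 1) / 4 = n at H ⊢
  refine PDvd.ratCongr ?_
  convert H.mul_integral (ofNat_mem (pIntegers p) 4) using 1
  have e1 : ∑ k ∈ range (n + 1), (8 * (k : ℚ) + 1) * rpoch (1 / 4) k ^ 4 / (k.factorial : ℚ) ^ 4 =
      4 * ∑ k ∈ range (n + 1), (1 / 4 + 2 * (k : ℚ)) * (rpoch (1 / 4) k / k.factorial) ^ 4 := by
    rw [mul_sum]
    exact sum_congr rfl fun k _ => by ring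
  have e2 : ∑ k ∈ Icc 1 n, rpoch 1 (k - 1) * rpoch (1 / 2) (k - 1) /
        ((4 * (k : ℚ) - 3) ^ 3 * rpoch (1 / 4) (k - 1) ^ 2) =
      1 / 64 * ∑ j ∈ range n, j.factorial * rpoch (2 * (1 / 4)) j /
        ((1 / 4 + (j : ℚ)) ^ 3 * rpoch (1 / 4) j ^ 2) := by
    rw [← Ico_succ_right_eq_Icc, sum_Ico_eq_sum_range, mul_sum]
    refine sum_congr rfl fun j _ => ?_
    rw [Nat.add_sub_cancel_left, rpoch_one, show (2 * (1 / 4) : ℚ) = 1 / 2 by norm_num,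
      show 4 * ((1 + j : ℕ) : ℚ) - 3 = 4 * (1 / 4 + j) by push_cast; ring, mul_pow, mul_assoc,
      ← div_div _ ((4 : ℚ) ^ 3), div_right_comm]
    ring
  rw [e1, e2, rpoch_one, show (2 * (1 / 4) : ℚ) = 1 / 2 by norm_num]
  ring
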